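/- arXiv:1511.09438 — 7 statements merged into one kernel-verified Lean document; each statement's English description precedes it below -/
import Mathlib

section
/- Let f be a proper extended real function and x̄ ∈ dom f. Suppose that for every direction u ∈ E with u ≠ 0, either f^{(1)}_↓(x̄;u) > 0, or there exists an integer n = n(u) ≥ 2 (depending on u) such that x̄ is a stationary point of order n − 1 and f^{(n)}_↓(x̄;u) > 0. Then x̄ is a strict local minimizer of f, i.e., there is a neighborhood N of x̄ with f(x) > f(x̄) for all x ∈ N with x ≠ x̄. -/
open Filter Topology

variable {E : Type*} [NormedAddCommGroup E] [InnerProductSpace ℝ E] [FiniteDimensional ℝ E]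

/-- The `n`-th order lower Hadamard directional derivative of `f` at `x` in direction `u`,
with zero lower-order terms:
`f^{(n)}_↓(x;u) = liminf_{t↓0, u'→u} n! t^{−n} [f(x + t u') − f(x)]`. -/
noncomputable def hadamardDeriv (f : E → EReal) (n : ℕ) (x u : E) : EReal :=
  Filter.liminf
    (fun p : ℝ × E =>
      (((n.factorial : ℝ) * (p.1 ^ n)⁻¹ : ℝ) : EReal) * (f (x + p.1 • p.2) - f x))
    ((𝓝[>] (0:ℝ)) ×ˢ 𝓝 u)

/-- `x` is a stationary point of order `n` for `f`:
`f^{(k)}_↓(x;u) ≥ 0` for all directions `u` and all `k = 1, …, n`. -/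
def StationaryOfOrder (f : E → EReal) (n : ℕ) (x : E) : Prop :=
  ∀ k : ℕ, 1 ≤ k → k ≤ n → ∀ u : E, 0 ≤ hadamardDeriv f k x u

/-- A positive lower Hadamard derivative at `x` in direction `u` forces `f` to exceed `f x` at
`x + t • u'` for all small `t > 0` and all `u'` near `u`. -/
theorem eventually_lt_of_hadamardDeriv_pos {f : E → EReal} {n : ℕ} {x u : E}
    (h : 0 < hadamardDeriv f n x u) :
    ∀ᶠ p : ℝ × E in (𝓝[>] (0 : ℝ)) ×ˢ 𝓝 u, f x < f (x + p.1 • p.2) := by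
  have hpos : ∀ᶠ p : ℝ × E in (𝓝[>] (0 : ℝ)) ×ˢ 𝓝 u, 0 < p.1 :=
    tendsto_fst.eventually self_mem_nhdsWithin
  filter_upwards [eventually_lt_of_lt_liminf h, hpos] with p hp ht
  have hc : 0 < (((n.factorial : ℝ) * (p.1 ^ n)⁻¹ : ℝ) : EReal) :=
    EReal.coe_pos.2 (by positivity)
  rcases EReal.mul_pos_iff.1 hp with h' | h'
  · exact EReal.sub_pos.1 h'.2
  · exact absurd h'.1 hc.not_gt

/-- If every direction `u ≠ 0` is one of local strict increase at `x`, uniformly near `u`, then `x`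
is a strict local minimizer, by compactness of the unit sphere. -/
theorem eventually_lt_of_forall_direction {f : E → EReal} {x : E}
    (h : ∀ u : E, u ≠ 0 →
      ∀ᶠ p : ℝ × E in (𝓝[>] (0 : ℝ)) ×ˢ 𝓝 u, f x < f (x + p.1 • p.2)) :
    ∀ᶠ y in 𝓝 x, y ≠ x → f x < f y := by
  have hmem : {p : ℝ × E | f x < f (x + p.1 • p.2)} ∈
      (𝓝[>] (0 : ℝ)) ×ˢ 𝓝ˢ (Metric.sphere (0 : E) 1) :=
    (isCompact_sphere (0 : E) 1).mem_prod_nhdsSet_of_forall fun u hu =>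
      h u (ne_zero_of_mem_unit_sphere ⟨u, hu⟩)
  obtain ⟨s, hs, t, ht, hst⟩ := mem_prod_iff.1 hmem
  obtain ⟨δ, hδ, hδs⟩ := mem_nhdsGT_iff_exists_Ioo_subset.1 hs
  filter_upwards [Metric.ball_mem_nhds x hδ] with y hy hyx
  have hpos : 0 < ‖y - x‖ := norm_pos_iff.2 (sub_ne_zero.2 hyx)
  have hdir : ‖y - x‖⁻¹ • (y - x) ∈ t := subset_of_mem_nhdsSet ht <| by
    simp [norm_smul, hpos.ne']
  have hlt := hst (Set.mk_mem_prod (hδs ⟨hpos, by rwa [← dist_eq_norm]⟩) hdir)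
  simpa [smul_smul, hpos.ne'] using hlt

/-- Sufficient conditions for a strict local minimum: if for every direction `u ≠ 0` either
`f^{(1)}_↓(x₀;u) > 0`, or there is an integer `n = n(u) ≥ 2` such that `x₀` is a stationary
point of order `n − 1` and `f^{(n)}_↓(x₀;u) > 0`, then `x₀` is a strict local minimizer. -/
theorem strict_local_min_of_higher_order_conditions
    (f : E → EReal) (hbot : ∀ y, f y ≠ ⊥) (hproper : ∃ y, f y ≠ ⊤)
    (x₀ : E) (hdom : f x₀ ≠ ⊤)
    (h : ∀ u : E, u ≠ 0 →
      0 < hadamardDeriv f 1 x₀ u ∨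
        ∃ n : ℕ, 2 ≤ n ∧ StationaryOfOrder f (n - 1) x₀ ∧ 0 < hadamardDeriv f n x₀ u) :
    ∃ N ∈ 𝓝 x₀, ∀ x ∈ N, x ≠ x₀ → f x₀ < f x := by
  refine ⟨_, eventually_lt_of_forall_direction fun u hu => ?_, fun _ hx => hx⟩
  rcases h u hu with h₁ | ⟨n, -, -, hn⟩
  · exact eventually_lt_of_hadamardDeriv_pos h₁
  · exact eventually_lt_of_hadamardDeriv_pos hn
end

section
/- Let f be a proper extended real function, x̄ ∈ dom f, and n ≥ 2 a positive integer. Then x̄ is an isolated local minimizer of order n if and only if x̄ is a stationary point of order n − 1 and f^{(n)}_↓(x̄;u) > 0 for every direction u ∈ E with u ≠ 0. -/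
open Filter Topology

variable {E : Type*} [NormedAddCommGroup E] [InnerProductSpace ℝ E] [FiniteDimensional ℝ E]

/-- `x₀` is an isolated local minimizer of order `n`: there are a constant `C > 0` and a
neighborhood `N` of `x₀` with `f x ≥ f x₀ + C ‖x − x₀‖ ^ n` for all `x ∈ N`. -/
def IsolatedLocalMinOfOrder (f : E → EReal) (n : ℕ) (x₀ : E) : Prop :=
  ∃ C : ℝ, 0 < C ∧ ∃ N ∈ 𝓝 x₀, ∀ x ∈ N, f x₀ + ((C * ‖x - x₀‖ ^ n : ℝ) : EReal) ≤ f x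

theorem EReal.coe_mul_le_coe_mul_of_nonneg {c r : ℝ} (hc : 0 ≤ c) {z : EReal}
    (h : (r : EReal) ≤ z) : ((c * r : ℝ) : EReal) ≤ (c : EReal) * z := by
  rw [EReal.coe_mul]
  exact mul_le_mul_of_nonneg_left h (EReal.coe_nonneg.2 hc)

theorem EReal.coe_le_of_le_coe_mul {c r : ℝ} (hc : 0 < c) {z : EReal}
    (h : ((c * r : ℝ) : EReal) ≤ (c : EReal) * z) : (r : EReal) ≤ z := by
  have h' := EReal.coe_mul_le_coe_mul_of_nonneg (inv_nonneg.2 hc.le) h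
  rwa [inv_mul_cancel_left₀ hc.ne', ← mul_assoc, ← EReal.coe_mul, inv_mul_cancel₀ hc.ne',
    EReal.coe_one, one_mul] at h'

theorem EReal.coe_le_sub_iff {y a : EReal} (hbot : a ≠ ⊥) (htop : a ≠ ⊤) (r : ℝ) :
    (r : EReal) ≤ y - a ↔ a + (r : EReal) ≤ y := by
  rw [EReal.le_sub_iff_add_le (Or.inl hbot) (Or.inl htop), add_comm]

/-- An isolated local minimizer of order `n` bounds from below the difference quotients of every
order `k` near every direction. -/
theorem IsolatedLocalMinOfOrder.eventually_le_quotient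
    {F : Type*} [NormedAddCommGroup F] [InnerProductSpace ℝ F]
    {f : F → EReal} {x₀ : F} {n : ℕ}
    (h : IsolatedLocalMinOfOrder f n x₀) (hbot : f x₀ ≠ ⊥) (htop : f x₀ ≠ ⊤) :
    ∃ C : ℝ, 0 < C ∧ ∀ (k : ℕ) (u : F), ∀ᶠ p : ℝ × F in (𝓝[>] (0 : ℝ)) ×ˢ 𝓝 u, 0 < p.1 ∧
      (((k.factorial : ℝ) * (p.1 ^ k)⁻¹ * (C * (p.1 * ‖p.2‖) ^ n) : ℝ) : EReal) ≤
        (((k.factorial : ℝ) * (p.1 ^ k)⁻¹ : ℝ) : EReal) * (f (x₀ + p.1 • p.2) - f x₀) := by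
  obtain ⟨C, hC, N, hN, hf⟩ := h
  refine ⟨C, hC, fun k u => ?_⟩
  have hpos : ∀ᶠ p : ℝ × F in (𝓝[>] (0 : ℝ)) ×ˢ 𝓝 u, 0 < p.1 :=
    tendsto_fst.eventually self_mem_nhdsWithin
  have hlim : Tendsto (fun p : ℝ × F => x₀ + p.1 • p.2) ((𝓝[>] (0 : ℝ)) ×ˢ 𝓝 u) (𝓝 x₀) := by
    have hfst : Tendsto Prod.fst ((𝓝[>] (0 : ℝ)) ×ˢ 𝓝 u) (𝓝 0) :=
      tendsto_fst.mono_right nhdsWithin_le_nhds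
    simpa using (hfst.smul tendsto_snd).const_add x₀
  filter_upwards [hpos, hlim.eventually hN] with p hp hpN
  refine ⟨hp, EReal.coe_mul_le_coe_mul_of_nonneg (by positivity) ?_⟩
  rw [EReal.coe_le_sub_iff hbot htop]
  simpa [norm_smul, abs_of_pos hp] using hf _ hpN

/-- Positivity of all `n`-th order lower Hadamard derivatives in the directions of a compact set
is uniform. -/
theorem IsCompact.exists_uniform_le_quotient
    {F : Type*} [NormedAddCommGroup F] [InnerProductSpace ℝ F]
    {f : F → EReal} {x : F} {n : ℕ} {K : Set F}
    (hK : IsCompact K) (h : ∀ u ∈ K, 0 < hadamardDeriv f n x u) :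
    ∃ c : ℝ, 0 < c ∧ ∃ δ : ℝ, 0 < δ ∧ ∀ u ∈ K, ∀ t : ℝ, 0 < t → t < δ →
      (c : EReal) ≤
        (((n.factorial : ℝ) * (t ^ n)⁻¹ : ℝ) : EReal) * (f (x + t • u) - f x) := by
  refine hK.induction_on
    (p := fun s => ∃ c : ℝ, 0 < c ∧ ∃ δ : ℝ, 0 < δ ∧ ∀ u ∈ s, ∀ t : ℝ, 0 < t → t < δ →
      (c : EReal) ≤
        (((n.factorial : ℝ) * (t ^ n)⁻¹ : ℝ) : EReal) * (f (x + t • u) - f x)) ?_ ?_ ?_ ?_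
  · exact ⟨1, one_pos, 1, one_pos, by simp⟩
  · rintro s t hst ⟨c, hc, δ, hδ, H⟩
    exact ⟨c, hc, δ, hδ, fun u hu => H u (hst hu)⟩
  · rintro s t ⟨c, hc, δ, hδ, H⟩ ⟨c', hc', δ', hδ', H'⟩
    refine ⟨min c c', lt_min hc hc', min δ δ', lt_min hδ hδ', ?_⟩
    rintro u (hu | hu) τ hτ hτδ
    · exact (EReal.coe_le_coe_iff.2 (min_le_left _ _)).trans
        (H u hu τ hτ (hτδ.trans_le (min_le_left _ _)))
    · exact (EReal.coe_le_coe_iff.2 (min_le_right _ _)).trans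
        (H' u hu τ hτ (hτδ.trans_le (min_le_right _ _)))
  · intro u hu
    obtain ⟨c, hc, hcu⟩ := EReal.lt_iff_exists_real_btwn.1 (h u hu)
    obtain ⟨P, hP, Q, hQ, H⟩ := eventually_prod_iff.1 (eventually_lt_of_lt_liminf hcu)
    obtain ⟨δ, hδ, hPδ⟩ := mem_nhdsGT_iff_exists_Ioo_subset.1 hP
    exact ⟨{v | Q v}, mem_nhdsWithin_of_mem_nhds hQ, c, EReal.coe_pos.1 hc, δ, hδ,
      fun v hv t ht htδ => (H (hPδ ⟨ht, htδ⟩) hv).le⟩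

/-- Characterization of isolated local minimizers of order `n ≥ 2`: `x₀` is an isolated local
minimizer of order `n` if and only if `x₀` is a stationary point of order `n − 1` and
`f^{(n)}_↓(x₀;u) > 0` for every direction `u ≠ 0`. -/
theorem isolatedLocalMin_iff_positive_hadamardDeriv
    (f : E → EReal) (hbot : ∀ y, f y ≠ ⊥) (hproper : ∃ y, f y ≠ ⊤)
    (x₀ : E) (hdom : f x₀ ≠ ⊤) (n : ℕ) (hn : 2 ≤ n) :
    IsolatedLocalMinOfOrder f n x₀ ↔
      (StationaryOfOrder f (n - 1) x₀ ∧
        ∀ u : E, u ≠ 0 → 0 < hadamardDeriv f n x₀ u) := by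
  constructor
  · intro h
    obtain ⟨C, hC, hquot⟩ := h.eventually_le_quotient (hbot x₀) hdom
    refine ⟨fun k _ _ u => ?_, fun u hu => ?_⟩
    · refine le_liminf_of_le (by isBoundedDefault) ?_
      filter_upwards [hquot k u] with p ⟨hp, hle⟩
      refine le_trans (EReal.coe_nonneg.2 ?_) hle
      positivity
    · have hu' : 0 < ‖u‖ := norm_pos_iff.2 hu
      have hpos : 0 < (n.factorial : ℝ) * (C * (‖u‖ / 2) ^ n) := by positivity
      refine (EReal.coe_pos.2 hpos).trans_le (le_liminf_of_le (by isBoundedDefault) ?_)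
      have hnorm : ∀ᶠ p : ℝ × E in (𝓝[>] (0 : ℝ)) ×ˢ 𝓝 u, ‖u‖ / 2 < ‖p.2‖ :=
        tendsto_snd.eventually (continuous_norm.continuousAt.eventually_const_lt (half_lt_self hu'))
      filter_upwards [hquot n u, hnorm] with p ⟨hp, hle⟩ hpu
      refine le_trans (EReal.coe_le_coe_iff.2 ?_) hle
      calc (n.factorial : ℝ) * (C * (‖u‖ / 2) ^ n)
          ≤ (n.factorial : ℝ) * (C * ‖p.2‖ ^ n) := by gcongr
        _ = (n.factorial : ℝ) * (p.1 ^ n)⁻¹ * (C * (p.1 * ‖p.2‖) ^ n) := by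
          rw [mul_pow]
          field_simp
  · rintro ⟨-, h⟩
    obtain ⟨c, hc, δ, hδ, H⟩ := (isCompact_sphere (0 : E) 1).exists_uniform_le_quotient
      fun u hu => h u (ne_zero_of_mem_unit_sphere ⟨u, hu⟩)
    refine ⟨c / n.factorial, by positivity, Metric.ball x₀ δ, Metric.ball_mem_nhds _ hδ,
      fun x hx => ?_⟩
    rcases eq_or_ne x x₀ with rfl | hne
    · simp [show n ≠ 0 by omega]
    have ht : 0 < ‖x - x₀‖ := norm_pos_iff.2 (sub_ne_zero.2 hne)
    have hq := H (‖x - x₀‖⁻¹ • (x - x₀)) (by simp [norm_smul, ht.ne']) _ ht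
      (mem_ball_iff_norm.1 hx)
    rw [smul_inv_smul₀ ht.ne', add_sub_cancel] at hq
    rw [← EReal.coe_le_sub_iff (hbot x₀) hdom]
    refine EReal.coe_le_of_le_coe_mul (c := n.factorial * (‖x - x₀‖ ^ n)⁻¹) (by positivity) ?_
    convert hq using 2
    field_simp
end

section
/- Let f be a proper extended real function, x̄ ∈ dom f, and n ≥ 2 a positive integer. Suppose x̄ is a stationary point of order n − 1 and that f^{(n)}_↓(x̄;u) > 0 for every nonzero critical direction u of order n − 1 at x̄ (i.e., every u ≠ 0 with f^{(k)}_↓(x̄;u) ≤ 0 for k = 1, …, n − 1). Then x̄ is an isolated local minimizer of order n. -/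
open Filter Topology

variable {E : Type*} [NormedAddCommGroup E] [InnerProductSpace ℝ E] [FiniteDimensional ℝ E]

/-- A positive lower Hadamard derivative of order `k` yields growth of every order `n ≥ k`
in all nearby directions. -/
theorem eventually_growth_of_hadamardDeriv_pos {F : Type*} [NormedAddCommGroup F]
    [InnerProductSpace ℝ F] (f : F → EReal) (hbot : ∀ y, f y ≠ ⊥) (x u : F)
    (hdom : f x ≠ ⊤) {k n : ℕ} (hkn : k ≤ n) (h : 0 < hadamardDeriv f k x u) :
    ∃ c : ℝ, 0 < c ∧ ∀ᶠ p : ℝ × F in (𝓝[>] (0 : ℝ)) ×ˢ 𝓝 u,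
      f x + ((c * p.1 ^ n : ℝ) : EReal) ≤ f (x + p.1 • p.2) := by
  obtain ⟨c, hc0, hc⟩ := EReal.lt_iff_exists_real_btwn.1 h
  have hc0' : 0 < c := by exact_mod_cast hc0
  have hk : (0 : ℝ) < k.factorial := by exact_mod_cast k.factorial_pos
  refine ⟨c / k.factorial, by positivity, ?_⟩
  have hsmall : ∀ᶠ p : ℝ × F in (𝓝[>] (0 : ℝ)) ×ˢ 𝓝 u, p.1 ∈ Set.Ioo (0 : ℝ) 1 :=
    tendsto_fst.eventually (Ioo_mem_nhdsGT one_pos)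
  filter_upwards [eventually_lt_of_lt_liminf hc, hsmall] with ⟨t, v⟩ hlt ⟨ht0, ht1⟩
  dsimp only at hlt ht0 ht1 ⊢
  obtain ⟨a, ha⟩ : ∃ a : ℝ, f x = a := ⟨_, (EReal.coe_toReal hdom (hbot x)).symm⟩
  by_cases htop : f (x + t • v) = ⊤
  · simp [htop]
  obtain ⟨y, hy⟩ : ∃ y : ℝ, f (x + t • v) = y :=
    ⟨_, (EReal.coe_toReal htop (hbot _)).symm⟩
  rw [ha, hy] at hlt ⊢
  norm_cast at hlt ⊢
  have htk : 0 < t ^ k := pow_pos ht0 k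
  have hpow : t ^ n ≤ t ^ k := pow_le_pow_of_le_one ht0.le ht1.le hkn
  have hmul : c / k.factorial * t ^ k < y - a := by
    calc c / k.factorial * t ^ k = c * (t ^ k / k.factorial) := by ring
      _ < k.factorial * (t ^ k)⁻¹ * (y - a) * (t ^ k / k.factorial) :=
        mul_lt_mul_of_pos_right hlt (div_pos htk hk)
      _ = y - a := by field_simp
  have := mul_le_mul_of_nonneg_left hpow (div_pos hc0' hk).le
  linarith

/-- Growth of order `n` near each direction of a compact set is uniform over that set. -/
theorem IsCompact.exists_uniform_growth {F : Type*} [NormedAddCommGroup F] [NormedSpace ℝ F]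
    (f : F → EReal) (x : F) (n : ℕ) {S : Set F}
    (hS : IsCompact S)
    (h : ∀ u ∈ S, ∃ c : ℝ, 0 < c ∧ ∀ᶠ p : ℝ × F in (𝓝[>] (0 : ℝ)) ×ˢ 𝓝 u,
      f x + ((c * p.1 ^ n : ℝ) : EReal) ≤ f (x + p.1 • p.2)) :
    ∃ c : ℝ, 0 < c ∧ ∀ᶠ t : ℝ in 𝓝[>] (0 : ℝ), ∀ v ∈ S,
      f x + ((c * t ^ n : ℝ) : EReal) ≤ f (x + t • v) := by
  have hmono : ∀ {c d t : ℝ}, c ≤ d → 0 < t →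
      f x + ((c * t ^ n : ℝ) : EReal) ≤ f x + ((d * t ^ n : ℝ) : EReal) := by
    intro c d t hcd ht
    gcongr
  refine hS.induction_on (p := fun T => ∃ c : ℝ, 0 < c ∧ ∀ᶠ t : ℝ in 𝓝[>] (0 : ℝ), ∀ v ∈ T,
      f x + ((c * t ^ n : ℝ) : EReal) ≤ f (x + t • v)) ⟨1, one_pos, by simp⟩ ?_ ?_ ?_
  · rintro T U hTU ⟨c, hc, hU⟩
    exact ⟨c, hc, hU.mono fun t ht v hv => ht v (hTU hv)⟩
  · rintro T U ⟨c, hc, hT⟩ ⟨d, hd, hU⟩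
    refine ⟨min c d, lt_min hc hd, ?_⟩
    filter_upwards [hT, hU, self_mem_nhdsWithin] with t htT htU ht v hv
    rcases hv with hv | hv
    · exact (hmono (min_le_left c d) ht).trans (htT v hv)
    · exact (hmono (min_le_right c d) ht).trans (htU v hv)
  · intro u hu
    obtain ⟨c, hc, hev⟩ := h u hu
    obtain ⟨P, hP, Q, hQ, hPQ⟩ := eventually_prod_iff.1 hev
    exact ⟨{v | Q v}, mem_nhdsWithin_of_mem_nhds hQ, c, hc, hP.mono fun t ht v hv => hPQ ht hv⟩

/-- Sufficiency via critical directions: if `x₀` is a stationary point of order `n − 1` and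
`f^{(n)}_↓(x₀;u) > 0` for every nonzero critical direction `u` of order `n − 1` at `x₀`
(i.e. every `u ≠ 0` with `f^{(k)}_↓(x₀;u) ≤ 0` for `k = 1, …, n − 1`), then `x₀` is an isolated
local minimizer of order `n`. -/
theorem isolatedLocalMin_of_critical_directions
    (f : E → EReal) (hbot : ∀ y, f y ≠ ⊥) (hproper : ∃ y, f y ≠ ⊤)
    (x₀ : E) (hdom : f x₀ ≠ ⊤) (n : ℕ) (hn : 2 ≤ n)
    (hstat : StationaryOfOrder f (n - 1) x₀)
    (hcrit : ∀ u : E, u ≠ 0 →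
      (∀ k : ℕ, 1 ≤ k → k ≤ n - 1 → hadamardDeriv f k x₀ u ≤ 0) →
      0 < hadamardDeriv f n x₀ u) :
    IsolatedLocalMinOfOrder f n x₀ := by
  have hlocal : ∀ u ∈ Metric.sphere (0 : E) 1,
      ∃ c : ℝ, 0 < c ∧ ∀ᶠ p : ℝ × E in (𝓝[>] (0 : ℝ)) ×ˢ 𝓝 u,
        f x₀ + ((c * p.1 ^ n : ℝ) : EReal) ≤ f (x₀ + p.1 • p.2) := by
    intro u hu
    by_cases hcritical : ∀ k : ℕ, 1 ≤ k → k ≤ n - 1 → hadamardDeriv f k x₀ u ≤ 0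
    · exact eventually_growth_of_hadamardDeriv_pos f hbot x₀ u hdom le_rfl
        (hcrit u (ne_zero_of_mem_unit_sphere ⟨u, hu⟩) hcritical)
    · push Not at hcritical
      obtain ⟨k, -, hk, hpos⟩ := hcritical
      exact eventually_growth_of_hadamardDeriv_pos f hbot x₀ u hdom (by omega) hpos
  obtain ⟨C, hC, hev⟩ := (isCompact_sphere (0 : E) 1).exists_uniform_growth f x₀ n hlocal
  obtain ⟨δ, hδ, hsub⟩ := mem_nhdsGT_iff_exists_Ioo_subset.1 hev
  refine ⟨C, hC, Metric.ball x₀ δ, Metric.ball_mem_nhds x₀ hδ, fun x hx => ?_⟩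
  rcases eq_or_ne x x₀ with rfl | hne
  · simp [show n ≠ 0 by omega]
  · have hpos : 0 < ‖x - x₀‖ := norm_pos_iff.2 (sub_ne_zero.2 hne)
    have hgrowth := hsub ⟨hpos, mem_ball_iff_norm.1 hx⟩ (‖x - x₀‖⁻¹ • (x - x₀))
      (by simp [norm_smul, hpos.ne'])
    rwa [smul_inv_smul₀ hpos.ne', add_sub_cancel] at hgrowth
end

section
/- Let f be a proper extended real function, x ∈ dom f, and n a positive integer. Then the Demyanov derivative of order n equals the minimum over the unit sphere of the Studniarski derivative of order n: there exists v ∈ E with ‖v‖ = 1 such that f↓_n(x) = d̲^n f(x;v) and d̲^n f(x;v) ≤ d̲^n f(x;u) for every u ∈ E with ‖u‖ = 1. -/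
open Filter Topology

variable {E : Type*} [NormedAddCommGroup E] [InnerProductSpace ℝ E] [FiniteDimensional ℝ E]
  [Nontrivial E]

/-- The Demyanov derivative of order `k`:
`f↓_k(x) = liminf_{y→x, y≠x} (f(y) − f(x))/‖y − x‖^k`. -/
noncomputable def demyanovDeriv (f : E → EReal) (k : ℕ) (x : E) : EReal :=
  Filter.liminf (fun y : E => (((‖y - x‖ ^ k)⁻¹ : ℝ) : EReal) * (f y - f x)) (𝓝[≠] x)

/-- The Studniarski derivative of order `n`:
`d̲^n f(x;u) = liminf_{t↓0, u'→u} t^{−n} (f(x + t u') − f(x))`. -/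
noncomputable def studniarskiDeriv (f : E → EReal) (n : ℕ) (x u : E) : EReal :=
  Filter.liminf
    (fun p : ℝ × E => ((((p.1 ^ n)⁻¹ : ℝ)) : EReal) * (f (x + p.1 • p.2) - f x))
    ((𝓝[>] (0:ℝ)) ×ˢ 𝓝 u)

/-- The Demyanov derivative is a lower bound for the Studniarski derivatives along unit vectors. -/
theorem demyanovDeriv_le_studniarskiDeriv (f : E → EReal) (n : ℕ) (x u : E) (hu : ‖u‖ = 1) :
    demyanovDeriv f n x ≤ studniarskiDeriv f n x u := by
  refine EReal.ge_of_forall_gt_iff_ge.1 fun r hr => ?_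
  obtain ⟨s, hrs, hs⟩ := EReal.exists_between_coe_real hr
  have hq := eventually_lt_of_lt_liminf hs
  have hfst : Tendsto Prod.fst ((𝓝[>] (0 : ℝ)) ×ˢ 𝓝 u) (𝓝[>] (0 : ℝ)) := tendsto_fst
  have hsnd : Tendsto Prod.snd ((𝓝[>] (0 : ℝ)) ×ˢ 𝓝 u) (𝓝 u) := tendsto_snd
  have hu0 : u ≠ 0 := norm_ne_zero_iff.1 (by simp [hu])
  have hpos : ∀ᶠ p : ℝ × E in (𝓝[>] (0 : ℝ)) ×ˢ 𝓝 u, 0 < p.1 :=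
    hfst.eventually self_mem_nhdsWithin
  have hne : ∀ᶠ p : ℝ × E in (𝓝[>] (0 : ℝ)) ×ˢ 𝓝 u, p.2 ≠ 0 :=
    hsnd.eventually (eventually_ne_nhds hu0)
  have hpoint : Tendsto (fun p : ℝ × E => x + p.1 • p.2) ((𝓝[>] (0 : ℝ)) ×ˢ 𝓝 u) (𝓝[≠] x) := by
    refine tendsto_nhdsWithin_iff.2 ⟨?_, ?_⟩
    · simpa using tendsto_const_nhds.add ((tendsto_nhdsWithin_iff.1 hfst).1.smul hsnd)
    · filter_upwards [hpos, hne] with p hp hp'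
      simp [hp.ne', hp']
  have hscale : ∀ᶠ p : ℝ × E in (𝓝[>] (0 : ℝ)) ×ˢ 𝓝 u, r < ‖p.2‖ ^ n * s := by
    have h : Tendsto (fun p : ℝ × E => ‖p.2‖ ^ n * s) ((𝓝[>] (0 : ℝ)) ×ˢ 𝓝 u) (𝓝 s) := by
      simpa [hu] using (hsnd.norm.pow n).mul_const s
    exact h.eventually (lt_mem_nhds (EReal.coe_lt_coe_iff.1 hrs))
  refine le_liminf_of_le (by isBoundedDefault) ?_
  filter_upwards [hpos, hne, hpoint.eventually hq, hscale] with p hp hp' hpq hps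
  have hnorm : (p.1 ^ n)⁻¹ = ‖p.2‖ ^ n * (‖x + p.1 • p.2 - x‖ ^ n)⁻¹ := by
    have := norm_ne_zero_iff.2 hp'
    rw [add_sub_cancel_left, norm_smul, Real.norm_of_nonneg hp.le, mul_pow]
    field_simp
  rw [hnorm, EReal.coe_mul, mul_assoc]
  calc (r : EReal) ≤ ((‖p.2‖ ^ n * s : ℝ) : EReal) := EReal.coe_le_coe_iff.2 hps.le
    _ = ((‖p.2‖ ^ n : ℝ) : EReal) * s := EReal.coe_mul _ _
    _ ≤ _ := mul_le_mul_of_nonneg_left hpq.le (EReal.coe_nonneg.2 (by positivity))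

/-- Some Studniarski derivative along a unit vector is at most the Demyanov derivative. -/
theorem exists_studniarskiDeriv_le_demyanovDeriv (f : E → EReal) (n : ℕ) (x : E) :
    ∃ v : E, ‖v‖ = 1 ∧ studniarskiDeriv f n x v ≤ demyanovDeriv f n x := by
  by_contra! hlt
  obtain ⟨w, hw⟩ := exists_norm_eq E zero_le_one
  have hunif : ∃ r, demyanovDeriv f n x < r ∧ ∀ᶠ y in 𝓝[≠] x,
      ‖y - x‖⁻¹ • (y - x) ∈ Metric.sphere (0 : E) 1 →
        r ≤ (((‖y - x‖ ^ n)⁻¹ : ℝ) : EReal) * (f y - f x) := by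
    refine (isCompact_sphere (0 : E) 1).induction_on
      (p := fun s => ∃ r, demyanovDeriv f n x < r ∧ ∀ᶠ y in 𝓝[≠] x,
        ‖y - x‖⁻¹ • (y - x) ∈ s → r ≤ (((‖y - x‖ ^ n)⁻¹ : ℝ) : EReal) * (f y - f x))
      ⟨_, hlt w hw, by simp⟩ ?_ ?_ ?_
    · rintro s t hst ⟨r, hr, h⟩
      exact ⟨r, hr, h.mono fun y hy hys => hy (hst hys)⟩
    · rintro s t ⟨r, hr, h⟩ ⟨r', hr', h'⟩
      refine ⟨min r r', lt_min hr hr', ?_⟩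
      filter_upwards [h, h'] with y hy hy'
      rintro (hys | hyt)
      · exact (min_le_left _ _).trans (hy hys)
      · exact (min_le_right _ _).trans (hy' hyt)
    · intro v hv
      obtain ⟨r, hr, hrv⟩ := exists_between (hlt v (by simpa using hv))
      obtain ⟨P, hP, Q, hQ, hPQ⟩ := eventually_prod_iff.1 (eventually_lt_of_lt_liminf hrv)
      refine ⟨{z | Q z}, mem_nhdsWithin_of_mem_nhds hQ, r, hr, ?_⟩
      have hnorm : Tendsto (fun y : E => ‖y - x‖) (𝓝[≠] x) (𝓝[>] 0) :=
        tendsto_norm_sub_self_nhdsNE x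
      filter_upwards [hnorm.eventually hP, self_mem_nhdsWithin] with y hy hyx hyQ
      have h0 : ‖y - x‖ ≠ 0 := norm_ne_zero_iff.2 (sub_ne_zero.2 hyx)
      have h := hPQ hy hyQ
      simp only [smul_inv_smul₀ h0, add_sub_cancel] at h
      exact h.le
  obtain ⟨r, hr, h⟩ := hunif
  refine hr.not_ge (le_liminf_of_le (by isBoundedDefault) ?_)
  filter_upwards [h, self_mem_nhdsWithin] with y hy hyx
  have h0 : ‖y - x‖ ≠ 0 := norm_ne_zero_iff.2 (sub_ne_zero.2 hyx)
  exact hy (by simp [norm_smul, h0])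

/-- The Demyanov derivative of order `n` equals the minimum over the unit sphere of the
Studniarski derivative of order `n`: there is `v` with `‖v‖ = 1` such that
`f↓_n(x) = d̲^n f(x;v)` and `d̲^n f(x;v) ≤ d̲^n f(x;u)` for every `u` with `‖u‖ = 1`. -/
theorem demyanovDeriv_eq_min_studniarskiDeriv
    (f : E → EReal) (hbot : ∀ y, f y ≠ ⊥) (hproper : ∃ y, f y ≠ ⊤)
    (x : E) (hdom : f x ≠ ⊤) (n : ℕ) (hn : 1 ≤ n) :
    ∃ v : E, ‖v‖ = 1 ∧ demyanovDeriv f n x = studniarskiDeriv f n x v ∧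
      ∀ u : E, ‖u‖ = 1 → studniarskiDeriv f n x v ≤ studniarskiDeriv f n x u := by
  obtain ⟨v, hv, hle⟩ := exists_studniarskiDeriv_le_demyanovDeriv f n x
  exact ⟨v, hv, (demyanovDeriv_le_studniarskiDeriv f n x v hv).antisymm hle,
    fun u hu => hle.trans (demyanovDeriv_le_studniarskiDeriv f n x u hu)⟩
end

section
/- Let f be a proper extended real function, x̄ ∈ dom f, and n a positive integer. Then x̄ is an isolated local minimizer of order n if and only if f↓_n(x̄) > 0. -/
open Filter Topology

variable {E : Type*} [NormedAddCommGroup E] [InnerProductSpace ℝ E] [FiniteDimensional ℝ E]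

theorem EReal.coe_add_mul_le_iff_le_inv_mul_sub {a C r : ℝ} {z : EReal} (hz : z ≠ ⊥)
    (hr : 0 < r) :
    (a : EReal) + ((C * r : ℝ) : EReal) ≤ z ↔ (C : EReal) ≤ ((r⁻¹ : ℝ) : EReal) * (z - a) := by
  induction z with
  | bot => exact absurd rfl hz
  | top => simp [EReal.coe_mul_top_of_pos (inv_pos.2 hr)]
  | coe z =>
    norm_cast
    rw [← div_eq_inv_mul, le_div_iff₀ hr, le_sub_iff_add_le']

/-- `x₀` is an isolated local minimizer of order `n` if and only if `f↓_n(x₀) > 0`. -/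
theorem isolatedLocalMin_iff_demyanovDeriv_pos
    (f : E → EReal) (hbot : ∀ y, f y ≠ ⊥) (hproper : ∃ y, f y ≠ ⊤)
    (x₀ : E) (hdom : f x₀ ≠ ⊤) (n : ℕ) (hn : 1 ≤ n) :
    IsolatedLocalMinOfOrder f n x₀ ↔ 0 < demyanovDeriv f n x₀ := by
  have hreal : ((f x₀).toReal : EReal) = f x₀ := EReal.coe_toReal hdom (hbot x₀)
  have growth_iff (C : ℝ) {y : E} (hy : y ≠ x₀) :
      f x₀ + ((C * ‖y - x₀‖ ^ n : ℝ) : EReal) ≤ f y ↔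
        (C : EReal) ≤ (((‖y - x₀‖ ^ n)⁻¹ : ℝ) : EReal) * (f y - f x₀) := by
    rw [← hreal]
    exact EReal.coe_add_mul_le_iff_le_inv_mul_sub (hbot y)
      (pow_pos (norm_pos_iff.2 (sub_ne_zero.2 hy)) n)
  constructor
  · rintro ⟨C, hC, N, hN, hgrowth⟩
    refine (EReal.coe_pos.2 hC).trans_le (le_liminf_of_le (by isBoundedDefault) ?_)
    filter_upwards [mem_nhdsWithin_of_mem_nhds hN, self_mem_nhdsWithin] with y hyN hy
    exact (growth_iff C hy).1 (hgrowth y hyN)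
  · intro hpos
    obtain ⟨C, hC, hlt⟩ := EReal.lt_iff_exists_real_btwn.1 hpos
    have hev := eventually_nhdsWithin_iff.1 (eventually_lt_of_lt_liminf hlt)
    refine ⟨C, EReal.coe_pos.1 hC, _, hev, fun y hy => ?_⟩
    rcases eq_or_ne y x₀ with rfl | hne
    · simp [Nat.one_le_iff_ne_zero.1 hn]
    · exact (growth_iff C hne).2 (hy hne).le
end

section
/- Let f be a proper extended real function, x̄ ∈ dom f, and n ≥ 2 a positive integer. Then the following are equivalent: (a) x̄ is an isolated local minimizer of order n and for every positive integer k < n, x̄ is not an isolated local minimizer of order k; (b) x̄ is a stationary point of order n − 1, f^{(n)}_↓(x̄;u) > 0 for every u ∈ E with u ≠ 0, and for every positive integer k < n there exists a direction d_k ≠ 0 with f^{(k)}_↓(x̄;d_k) = 0. -/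
open Filter Topology

variable {E : Type*} [NormedAddCommGroup E] [InnerProductSpace ℝ E] [FiniteDimensional ℝ E]

/-- Clearing a positive factor in a lower bound for an extended real difference quotient. -/
theorem EReal.coe_le_coe_mul_sub_coe_iff {y : EReal} (hy : y ≠ ⊥) {c : ℝ} (hc : 0 < c) (m r : ℝ) :
    (m : EReal) ≤ (c : EReal) * (y - r) ↔ (r : EReal) + ((m / c : ℝ) : EReal) ≤ y := by
  induction y with
  | bot => exact absurd rfl hy
  | top => simp [EReal.coe_mul_top_of_pos hc]
  | coe y =>
    norm_cast
    rw [← le_sub_iff_add_le', div_le_iff₀' hc]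

section HadamardDerivative

variable {F : Type*} [NormedAddCommGroup F] [InnerProductSpace ℝ F]
  {f : F → EReal} {x₀ : F}

theorem coe_le_hadamardQuotient_iff (hbot : ∀ y, f y ≠ ⊥) {r : ℝ} (hr : f x₀ = r)
    (n : ℕ) {t : ℝ} (ht : 0 < t) (u : F) (m : ℝ) :
    (m : EReal) ≤
        (((n.factorial : ℝ) * (t ^ n)⁻¹ : ℝ) : EReal) * (f (x₀ + t • u) - f x₀) ↔
      f x₀ + ((m / n.factorial * t ^ n : ℝ) : EReal) ≤ f (x₀ + t • u) := by
  have hn : (0 : ℝ) < n.factorial := by exact_mod_cast n.factorial_pos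
  rw [hr, EReal.coe_le_coe_mul_sub_coe_iff (hbot _) (by positivity)]
  rw [show m / ((n.factorial : ℝ) * (t ^ n)⁻¹) = m / n.factorial * t ^ n by field_simp]

theorem coe_le_hadamardDeriv (hbot : ∀ y, f y ≠ ⊥) {r : ℝ} (hr : f x₀ = r) {n : ℕ} {u : F} {m : ℝ}
    (h : ∀ᶠ p : ℝ × F in (𝓝[>] (0 : ℝ)) ×ˢ 𝓝 u,
      f x₀ + ((m / n.factorial * p.1 ^ n : ℝ) : EReal) ≤ f (x₀ + p.1 • p.2)) :
    (m : EReal) ≤ hadamardDeriv f n x₀ u := by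
  refine le_liminf_of_le (by isBoundedDefault) ?_
  have hpos : ∀ᶠ p : ℝ × F in (𝓝[>] (0 : ℝ)) ×ˢ 𝓝 u, 0 < p.1 :=
    tendsto_fst.eventually self_mem_nhdsWithin
  filter_upwards [h, hpos] with p hp ht
  exact (coe_le_hadamardQuotient_iff hbot hr n ht p.2 m).2 hp

theorem IsolatedLocalMinOfOrder.eventually_le {n : ℕ} (h : IsolatedLocalMinOfOrder f n x₀) (u : F) :
    ∃ C : ℝ, 0 < C ∧ ∀ᶠ p : ℝ × F in (𝓝[>] (0 : ℝ)) ×ˢ 𝓝 u,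
      f x₀ + ((C * ‖p.1 • p.2‖ ^ n : ℝ) : EReal) ≤ f (x₀ + p.1 • p.2) := by
  obtain ⟨C, hC, N, hN, hf⟩ := h
  refine ⟨C, hC, ?_⟩
  have hlim : Tendsto (fun p : ℝ × F => x₀ + p.1 • p.2) ((𝓝[>] (0 : ℝ)) ×ˢ 𝓝 u) (𝓝 x₀) := by
    have hcont : Continuous fun p : ℝ × F => x₀ + p.1 • p.2 := by fun_prop
    have := hcont.tendsto ((0 : ℝ), u)
    rw [zero_smul, add_zero, nhds_prod_eq] at this
    exact this.mono_left (prod_mono nhdsWithin_le_nhds le_rfl)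
  filter_upwards [hlim.eventually_mem hN] with p hp
  simpa using hf _ hp

theorem IsolatedLocalMinOfOrder.hadamardDeriv_nonneg (hbot : ∀ y, f y ≠ ⊥) {r : ℝ} (hr : f x₀ = r)
    {n : ℕ} (h : IsolatedLocalMinOfOrder f n x₀) (k : ℕ) (u : F) :
    0 ≤ hadamardDeriv f k x₀ u := by
  obtain ⟨C, hC, hf⟩ := h.eventually_le u
  refine mod_cast coe_le_hadamardDeriv (m := 0) hbot hr ?_
  filter_upwards [hf] with p hp
  refine le_trans (add_le_add_right ?_ _) hp
  rw [EReal.coe_le_coe_iff, zero_div, zero_mul]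
  positivity

theorem IsolatedLocalMinOfOrder.hadamardDeriv_pos (hbot : ∀ y, f y ≠ ⊥) {r : ℝ} (hr : f x₀ = r)
    {n : ℕ} (h : IsolatedLocalMinOfOrder f n x₀) {u : F} (hu : u ≠ 0) :
    0 < hadamardDeriv f n x₀ u := by
  obtain ⟨C, hC, hf⟩ := h.eventually_le u
  have hn : (0 : ℝ) < n.factorial := by exact_mod_cast n.factorial_pos
  have hu' : 0 < ‖u‖ := norm_pos_iff.2 hu
  have hm : (0 : ℝ) < n.factorial * (C * (‖u‖ / 2) ^ n) := by positivity
  refine lt_of_lt_of_le (mod_cast hm) (coe_le_hadamardDeriv (m := _) hbot hr ?_)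
  have hpos : ∀ᶠ p : ℝ × F in (𝓝[>] (0 : ℝ)) ×ˢ 𝓝 u, 0 < p.1 :=
    tendsto_fst.eventually self_mem_nhdsWithin
  have hnorm : ∀ᶠ p : ℝ × F in (𝓝[>] (0 : ℝ)) ×ˢ 𝓝 u, ‖u‖ / 2 < ‖p.2‖ :=
    tendsto_snd.norm.eventually_const_lt (half_lt_self hu')
  filter_upwards [hf, hpos, hnorm] with p hp ht hpu
  refine le_trans (add_le_add_right ?_ _) hp
  rw [EReal.coe_le_coe_iff, mul_div_cancel_left₀ _ hn.ne', norm_smul, mul_pow,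
    Real.norm_of_nonneg ht.le, mul_assoc, mul_comm (p.1 ^ n)]
  gcongr

variable {f : E → EReal} {x₀ : E}

/-- Positivity of the lower Hadamard derivative gives growth of order `n` that is uniform over
the unit sphere. -/
theorem exists_uniform_growth_on_sphere (hbot : ∀ y, f y ≠ ⊥) {r : ℝ} (hr : f x₀ = r)
    {n : ℕ} (h : ∀ u : E, u ≠ 0 → 0 < hadamardDeriv f n x₀ u) :
    ∃ C : ℝ, 0 < C ∧ ∀ᶠ t in 𝓝[>] (0 : ℝ), ∀ u ∈ Metric.sphere (0 : E) 1,
      f x₀ + ((C * t ^ n : ℝ) : EReal) ≤ f (x₀ + t • u) := by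
  have hn : (0 : ℝ) < n.factorial := by exact_mod_cast n.factorial_pos
  have hpos : ∀ᶠ t in 𝓝[>] (0 : ℝ), 0 < t := self_mem_nhdsWithin
  have hweaken : ∀ {c C t : ℝ} {y : EReal}, c ≤ C → 0 < t →
      f x₀ + ((C * t ^ n : ℝ) : EReal) ≤ y → f x₀ + ((c * t ^ n : ℝ) : EReal) ≤ y := by
    intro c C t y hcC ht hy
    refine le_trans (add_le_add_right ?_ _) hy
    rw [EReal.coe_le_coe_iff]
    gcongr
  refine (isCompact_sphere (0 : E) 1).induction_on
    (p := fun s => ∃ C : ℝ, 0 < C ∧ ∀ᶠ t in 𝓝[>] (0 : ℝ), ∀ u ∈ s,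
      f x₀ + ((C * t ^ n : ℝ) : EReal) ≤ f (x₀ + t • u)) ⟨1, one_pos, by simp⟩ ?_ ?_ ?_
  · rintro s s' hs ⟨C, hC, hev⟩
    exact ⟨C, hC, hev.mono fun t ht u hu => ht u (hs hu)⟩
  · rintro s s' ⟨C, hC, hev⟩ ⟨C', hC', hev'⟩
    refine ⟨min C C', lt_min hC hC', ?_⟩
    filter_upwards [hev, hev', hpos] with t ht ht' htpos u hu
    rcases hu with hu | hu
    · exact hweaken (min_le_left _ _) htpos (ht u hu)
    · exact hweaken (min_le_right _ _) htpos (ht' u hu)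
  · intro u hu
    obtain ⟨m, hm, hlt⟩ := EReal.lt_iff_exists_real_btwn.1 (h u (ne_zero_of_mem_unit_sphere ⟨u, hu⟩))
    obtain ⟨pa, ha, pb, hb, hab⟩ := eventually_prod_iff.1 (eventually_lt_of_lt_liminf hlt)
    refine ⟨{v | pb v}, mem_nhdsWithin_of_mem_nhds hb, m / n.factorial,
      div_pos (mod_cast hm) hn, ?_⟩
    filter_upwards [ha, hpos] with t ht htpos v hv
    exact (coe_le_hadamardQuotient_iff hbot hr n htpos v m).1 (hab ht hv).le

theorem isolatedLocalMinOfOrder_of_hadamardDeriv_pos (hbot : ∀ y, f y ≠ ⊥) {r : ℝ}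
    (hr : f x₀ = r) {n : ℕ} (hn : n ≠ 0) (h : ∀ u : E, u ≠ 0 → 0 < hadamardDeriv f n x₀ u) :
    IsolatedLocalMinOfOrder f n x₀ := by
  obtain ⟨C, hC, hev⟩ := exists_uniform_growth_on_sphere hbot hr h
  obtain ⟨δ, hδ, hsub⟩ := mem_nhdsGT_iff_exists_Ioo_subset.1 hev
  refine ⟨C, hC, Metric.ball x₀ δ, Metric.ball_mem_nhds x₀ hδ, fun x hx => ?_⟩
  rcases eq_or_ne x x₀ with rfl | hne
  · simp [hn]
  have hnorm : 0 < ‖x - x₀‖ := norm_pos_iff.2 (sub_ne_zero.2 hne)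
  have := hsub ⟨hnorm, mem_ball_iff_norm.1 hx⟩ (‖x - x₀‖⁻¹ • (x - x₀))
    (by simp [norm_smul, hnorm.ne'])
  simpa [smul_smul, hnorm.ne'] using this

/-- Characterization of isolated local minimizers of order `n`. -/
theorem isolatedLocalMinOfOrder_iff_hadamardDeriv_pos (hbot : ∀ y, f y ≠ ⊥) {r : ℝ}
    (hr : f x₀ = r) {n : ℕ} (hn : n ≠ 0) :
    IsolatedLocalMinOfOrder f n x₀ ↔ ∀ u : E, u ≠ 0 → 0 < hadamardDeriv f n x₀ u :=
  ⟨fun h _ hu => h.hadamardDeriv_pos hbot hr hu,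
    isolatedLocalMinOfOrder_of_hadamardDeriv_pos hbot hr hn⟩

end HadamardDerivative

/-- Characterization of the isolated local minimizers of exact order `n ≥ 2`: `x₀` is an
isolated local minimizer of order `n` but of no order `k < n` if and only if `x₀` is a
stationary point of order `n − 1`, `f^{(n)}_↓(x₀;u) > 0` for every `u ≠ 0`, and for every
positive integer `k < n` there is a direction `d ≠ 0` with `f^{(k)}_↓(x₀;d) = 0`. -/
theorem exact_order_isolatedLocalMin_iff_hadamard
    (f : E → EReal) (hbot : ∀ y, f y ≠ ⊥) (hproper : ∃ y, f y ≠ ⊤)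
    (x₀ : E) (hdom : f x₀ ≠ ⊤) (n : ℕ) (hn : 2 ≤ n) :
    (IsolatedLocalMinOfOrder f n x₀ ∧
        ∀ k : ℕ, 1 ≤ k → k < n → ¬ IsolatedLocalMinOfOrder f k x₀) ↔
      (StationaryOfOrder f (n - 1) x₀ ∧
        (∀ u : E, u ≠ 0 → 0 < hadamardDeriv f n x₀ u) ∧
        ∀ k : ℕ, 1 ≤ k → k < n → ∃ d : E, d ≠ 0 ∧ hadamardDeriv f k x₀ d = 0) := by
  obtain ⟨r, hr⟩ : ∃ r : ℝ, f x₀ = r := ⟨_, (EReal.coe_toReal hdom (hbot x₀)).symm⟩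
  have hiff {k : ℕ} (hk : k ≠ 0) :=
    isolatedLocalMinOfOrder_iff_hadamardDeriv_pos (n := k) hbot hr hk
  constructor
  · rintro ⟨hmin, hnot⟩
    have hnonneg := hmin.hadamardDeriv_nonneg hbot hr
    refine ⟨fun k _ _ u => hnonneg k u, (hiff (by omega)).1 hmin, fun k hk hkn => ?_⟩
    have hk' := hnot k hk hkn
    rw [hiff (by omega)] at hk'
    push Not at hk'
    obtain ⟨d, hd, hle⟩ := hk'
    exact ⟨d, hd, le_antisymm hle (hnonneg k d)⟩
  · rintro ⟨-, hpos, hzero⟩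
    refine ⟨(hiff (by omega)).2 hpos, fun k hk hkn hmin => ?_⟩
    obtain ⟨d, hd, hd0⟩ := hzero k hk hkn
    exact ((hiff (by omega)).1 hmin d hd).ne' hd0
end

section
/- Let f be a proper extended real function, x̄ ∈ dom f, and n a positive integer. Then the following are equivalent: (a) x̄ is an isolated local minimizer of order n and for every positive integer k < n, x̄ is not an isolated local minimizer of order k; (c) f↓_k(x̄) = 0 for every positive integer k < n and f↓_n(x̄) > 0. -/
open Filter Topology

variable {E : Type*} [NormedAddCommGroup E] [InnerProductSpace ℝ E] [FiniteDimensional ℝ E]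

theorem EReal.coe_le_inv_mul_sub_coe_iff {r : ℝ} (hr : 0 < r) (a c : ℝ) {z : EReal}
    (hz : z ≠ ⊥) :
    (c : EReal) ≤ ((r⁻¹ : ℝ) : EReal) * (z - a) ↔ (a : EReal) + ((c * r : ℝ) : EReal) ≤ z := by
  induction z with
  | bot => exact absurd rfl hz
  | top => simp [EReal.coe_mul_top_of_pos (inv_pos.mpr hr)]
  | coe z =>
    norm_cast
    rw [inv_mul_eq_div, le_div_iff₀ hr, le_sub_iff_add_le']

theorem coe_le_demyanov_quotient_iff {F : Type*} [NormedAddCommGroup F]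
    {f : F → EReal} (hbot : ∀ y, f y ≠ ⊥) {x₀ : F}
    (hdom : f x₀ ≠ ⊤) (k : ℕ) (c : ℝ) {y : F} (hy : y ≠ x₀) :
    (c : EReal) ≤ (((‖y - x₀‖ ^ k)⁻¹ : ℝ) : EReal) * (f y - f x₀) ↔
      f x₀ + ((c * ‖y - x₀‖ ^ k : ℝ) : EReal) ≤ f y := by
  have hr : 0 < ‖y - x₀‖ ^ k := pow_pos (norm_pos_iff.mpr (sub_ne_zero.mpr hy)) k
  have h := EReal.coe_le_inv_mul_sub_coe_iff hr (f x₀).toReal c (hbot y)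
  rwa [EReal.coe_toReal hdom (hbot x₀)] at h

theorem isolatedLocalMinOfOrder_iff_demyanovDeriv_pos {F : Type*} [NormedAddCommGroup F]
    {f : F → EReal} (hbot : ∀ y, f y ≠ ⊥)
    {x₀ : F} (hdom : f x₀ ≠ ⊤) {k : ℕ} (hk : k ≠ 0) :
    IsolatedLocalMinOfOrder f k x₀ ↔ 0 < demyanovDeriv f k x₀ := by
  constructor
  · rintro ⟨C, hC, N, hN, h⟩
    refine (EReal.coe_pos.mpr hC).trans_le (le_liminf_of_le (by isBoundedDefault) ?_)
    filter_upwards [mem_nhdsWithin_of_mem_nhds hN, self_mem_nhdsWithin] with y hyN hy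
    exact (coe_le_demyanov_quotient_iff hbot hdom k C hy).mpr (h y hyN)
  · intro h
    obtain ⟨C, hC, hlt⟩ := EReal.lt_iff_exists_real_btwn.mp h
    have hev := eventually_nhdsWithin_iff.mp (eventually_lt_of_lt_liminf hlt)
    refine ⟨C, EReal.coe_pos.mp hC, _, hev, fun y hy => ?_⟩
    rcases eq_or_ne y x₀ with rfl | hne
    · simp [hk]
    · exact (coe_le_demyanov_quotient_iff hbot hdom k C hne).mp (hy hne).le

theorem IsolatedLocalMinOfOrder.demyanovDeriv_nonneg {F : Type*} [NormedAddCommGroup F]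
    {f : F → EReal} (hbot : ∀ y, f y ≠ ⊥)
    {x₀ : F} (hdom : f x₀ ≠ ⊤) {n : ℕ} (h : IsolatedLocalMinOfOrder f n x₀) (k : ℕ) :
    0 ≤ demyanovDeriv f k x₀ := by
  obtain ⟨C, hC, N, hN, h⟩ := h
  refine le_liminf_of_le (by isBoundedDefault) ?_
  filter_upwards [mem_nhdsWithin_of_mem_nhds hN, self_mem_nhdsWithin] with y hyN hy
  refine (coe_le_demyanov_quotient_iff hbot hdom k 0 hy).mpr (le_trans ?_ (h y hyN))
  have hle : 0 * ‖y - x₀‖ ^ k ≤ C * ‖y - x₀‖ ^ n := by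
    rw [zero_mul]
    positivity
  exact add_le_add_right (EReal.coe_le_coe_iff.mpr hle) _

/-- `x₀` is an isolated local minimizer of order `n` but of no order `k < n` if and only if
`f↓_k(x₀) = 0` for every positive integer `k < n` and `f↓_n(x₀) > 0`. -/
theorem exact_order_isolatedLocalMin_iff_demyanov
    (f : E → EReal) (hbot : ∀ y, f y ≠ ⊥) (hproper : ∃ y, f y ≠ ⊤)
    (x₀ : E) (hdom : f x₀ ≠ ⊤) (n : ℕ) (hn : 1 ≤ n) :
    (IsolatedLocalMinOfOrder f n x₀ ∧
        ∀ k : ℕ, 1 ≤ k → k < n → ¬ IsolatedLocalMinOfOrder f k x₀) ↔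
      ((∀ k : ℕ, 1 ≤ k → k < n → demyanovDeriv f k x₀ = 0) ∧
        0 < demyanovDeriv f n x₀) := by
  constructor
  · rintro ⟨hmin, hnot⟩
    refine ⟨fun k hk hkn => le_antisymm (not_lt.mp fun hpos => hnot k hk hkn ?_)
      (hmin.demyanovDeriv_nonneg hbot hdom k), ?_⟩
    · exact (isolatedLocalMinOfOrder_iff_demyanovDeriv_pos hbot hdom (by omega)).mpr hpos
    · exact (isolatedLocalMinOfOrder_iff_demyanovDeriv_pos hbot hdom (by omega)).mp hmin
  · rintro ⟨hzero, hpos⟩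
    refine ⟨(isolatedLocalMinOfOrder_iff_demyanovDeriv_pos hbot hdom (by omega)).mpr hpos,
      fun k hk hkn hmin => ?_⟩
    exact ((isolatedLocalMinOfOrder_iff_demyanovDeriv_pos hbot hdom (by omega)).mp hmin).ne'
      (hzero k hk hkn)
end
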